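/- Suppose the buyer's value is uniform on [0,1] (so φ_B(v) = 2v - 1) and the seller's cost c has CDF G with density g on [0, c̄]. For the affine fee-setting mechanism with fee w(P) = (1-α)P + β where α - β = 1, the BNE price is P(c) = (c+β)/(2α) + 1/2, and the expected intermediary revenue E[w(P(c))·(1 - P(c))] equals ((α-1)/(2α²))·∫₀¹ G(c)(1-c) dc. In particular, since the maximum surplus is ∫₀¹ G(c)(1-c) dc, this mechanism is a 2α²/(α-1)-approximation to maximum surplus, minimized at α = 2 giving ratio 8. -/

import Mathlib

/-- With uniform [0,1] buyer and fee w(P)=(1-α)P+β, α-β=1, the intermediary's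
revenue equals ((α-1)/(2α²))·∫₀¹ G(c)(1-c)dc, with best ratio 8 at α = 2. -/
theorem stmt16 (α cbar : ℝ) (G g : ℝ → ℝ)
    (hα : 1 < α) (hcbar : cbar ∈ Set.Ioc (0:ℝ) 1)
    (hG0 : G 0 = 0) (hG1 : ∀ c, cbar ≤ c → G c = 1)
    (hg : ∀ c ∈ Set.Icc (0:ℝ) cbar, HasDerivWithinAt G (g c) (Set.Icc 0 cbar) c)
    (hgpos : ∀ c ∈ Set.Icc (0:ℝ) cbar, 0 ≤ g c)
    (hgc : ContinuousOn g (Set.Icc 0 cbar)) :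
    (∫ c in (0:ℝ)..cbar,
        ((1-α) * ((c+(α-1))/(2*α) + 1/2) + (α-1))
          * (1 - ((c+(α-1))/(2*α) + 1/2)) * g c)
      = ((α-1)/(2*α^2)) * (∫ c in (0:ℝ)..1, G c * (1-c)) ∧
    (2*(2:ℝ)^2/(2-1) = 8 ∧ ∀ α' : ℝ, 1 < α' → 8 ≤ 2*α'^2/(α'-1)) := by 
  obtain ⟨hc0, hc1⟩ := hcbar
  have hGc : ContinuousOn G (Set.Icc 0 cbar) := fun c hc => (hg c hc).continuousWithinAt
  have hu : Set.uIcc 0 cbar = Set.Icc 0 cbar := Set.uIcc_of_le hc0.le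
  have i1 : IntervalIntegrable (fun c => (1-c)^2 * g c) MeasureTheory.volume 0 cbar := by
    apply ContinuousOn.intervalIntegrable
    rw [hu]
    exact ContinuousOn.mul (by fun_prop) hgc
  have i2 : IntervalIntegrable (fun c => G c * (1-c)) MeasureTheory.volume 0 cbar := by
    apply ContinuousOn.intervalIntegrable
    rw [hu]
    exact ContinuousOn.mul hGc (by fun_prop)
  have e : Set.EqOn (fun c : ℝ => 1 - c) (fun c => G c * (1-c)) (Set.uIcc cbar 1) := by
    intro c hc
    rw [Set.uIcc_of_le hc1] at hc
    simp [hG1 c hc.1]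
  have i3 : IntervalIntegrable (fun c => G c * (1-c)) MeasureTheory.volume cbar 1 := by
    apply ContinuousOn.intervalIntegrable
    exact ContinuousOn.congr (f := fun c : ℝ => 1 - c) (by fun_prop) (fun c hc => (e hc).symm)
  have v3 : ∫ c in cbar..1, G c * (1-c) = (1-cbar)^2/2 := by
    rw [← intervalIntegral.integral_congr e]
    rw [intervalIntegral.integral_sub (by simp) (by simp)]
    simp
    ring
  have ftc := intervalIntegral.integral_eq_sub_of_hasDerivAt_of_le (a := 0) (b := cbar)
    (f := fun c => (1-c)^2 * G c) (f' := fun c => (1-c)^2 * g c - 2 * (G c * (1-c))) hc0.le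
    (ContinuousOn.mul (by fun_prop) hGc)
    (by
      intro c hc
      have h1 : HasDerivAt G (g c) c :=
        (hg c (Set.Ioo_subset_Icc_self hc)).hasDerivAt (Icc_mem_nhds hc.1 hc.2)
      have h2 := (((hasDerivAt_id c).const_sub 1).pow 2).mul h1
      refine HasDerivAt.congr_deriv (f := fun c => (1-c)^2 * G c) h2 ?_
      simp
      ring)
    (i1.sub (i2.const_mul 2))
  rw [intervalIntegral.integral_sub i1 (i2.const_mul 2),
    intervalIntegral.integral_const_mul] at ftc
  simp only [hG0, hG1 cbar le_rfl] at ftc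
  refine ⟨?_, by norm_num, ?_⟩
  · rw [← intervalIntegral.integral_add_adjacent_intervals i2 i3, v3]
    have hα0 : α ≠ 0 := by linarith
    have : ∀ c : ℝ, ((1-α) * ((c+(α-1))/(2*α) + 1/2) + (α-1))
          * (1 - ((c+(α-1))/(2*α) + 1/2)) * g c
        = ((α-1)/(4*α^2)) * ((1-c)^2 * g c) := by
      intro c
      field_simp
      ring
    simp only [this]
    rw [intervalIntegral.integral_const_mul, sub_eq_iff_eq_add.mp ftc]
    field_simp
    ring
  · intro a ha
    rw [le_div_iff₀ (by linarith)]
    nlinarith [sq_nonneg (a-2)]
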